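/- arXiv:2407.10635 — 2 statements merged into one kernel-verified Lean document; each statement's English description precedes it below -/
import Mathlib

section
/- Let Φ : Mₙ(ℂ) → Mₙ(ℂ) be a completely positive, trace-preserving, unital linear map such that Φ(X) = Y and there exists another completely positive, trace-preserving, unital map Ψ with Ψ(Y) = X. Then X and Y are cospectral, i.e., they have the same multiset of eigenvalues (in fact there is a unitary U with Y = UXU*). -/
open Matrix ComplexOrder

/-- A linear map `Φ : Mₙ(ℂ) → Mₘ(ℂ)` is completely positive if for every `l`,
`id_{M_l} ⊗ Φ` maps positive semidefinite matrices to positive semidefinite matrices. -/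
def IsCompletelyPositive {n m : Type*} [Fintype n] [Fintype m]
    (Φ : Matrix n n ℂ →ₗ[ℂ] Matrix m m ℂ) : Prop :=
  ∀ (l : ℕ) (M : Matrix (Fin l × n) (Fin l × n) ℂ), M.PosSemidef →
    (Matrix.of fun p q : Fin l × m =>
      Φ (Matrix.of fun x y => M (p.1, x) (q.1, y)) p.2 q.2).PosSemidef

/-- `L` intertwines both the pair `X`, `Y` and the pair of their adjoints. -/
structure StarIntertwines {R : Type*} [Mul R] [Star R] (X Y L : R) : Prop where
  mul_eq : L * X = Y * L
  mul_star_eq : L * star X = star Y * L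

namespace StarIntertwines

lemma adjoint {R : Type*} [Semigroup R] [StarMul R] {X Y L : R} (h : StarIntertwines X Y L) :
    StarIntertwines Y X (star L) where
  mul_eq := by simpa using (congrArg star h.mul_star_eq).symm
  mul_star_eq := by simpa using (congrArg star h.mul_eq).symm

lemma mul {R : Type*} [Semigroup R] [StarMul R] {X Y Z L M : R}
    (hL : StarIntertwines Y Z L) (hM : StarIntertwines X Y M) : StarIntertwines X Z (L * M) where
  mul_eq := by rw [mul_assoc, hM.mul_eq, ← mul_assoc, hL.mul_eq, mul_assoc]
  mul_star_eq := by rw [mul_assoc, hM.mul_star_eq, ← mul_assoc, hL.mul_star_eq, mul_assoc]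

lemma add {R : Type*} [NonUnitalSemiring R] [StarRing R] {X Y L M : R}
    (hL : StarIntertwines X Y L) (hM : StarIntertwines X Y M) : StarIntertwines X Y (L + M) where
  mul_eq := by rw [add_mul, mul_add, hL.mul_eq, hM.mul_eq]
  mul_star_eq := by rw [add_mul, mul_add, hL.mul_star_eq, hM.mul_star_eq]

end StarIntertwines

/-- The polar decomposition of an invertible intertwiner yields a unitary intertwiner. -/
lemma StarIntertwines.exists_unitary {A : Type*} [CStarAlgebra A] [PartialOrder A]
    [StarOrderedRing A] {X Y L : A} (hL : StarIntertwines X Y L) (hunit : IsUnit L) :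
    ∃ U ∈ unitary A, U * X = Y * U := by
  have hS := CFC.abs_mul_abs L
  have hcomm : Commute (CFC.abs L) X :=
    .cfcₙ_nnreal (hL.adjoint.mul hL).mul_eq _
  have hSsa : star (CFC.abs L) = CFC.abs L := (CFC.abs_nonneg L).isSelfAdjoint
  have hSunit : IsUnit (CFC.abs L) := by
    have : IsUnit (CFC.abs L * CFC.abs L) := hS ▸ hunit.star.mul hunit
    exact (Commute.isUnit_mul_iff rfl).1 this |>.1
  obtain ⟨S, hSL⟩ := hSunit
  rw [← hSL] at hS hcomm hSsa
  have hSinv : star (↑S⁻¹ : A) = ↑S⁻¹ := by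
    have : star S = S := Units.ext hSsa
    rw [← Units.coe_star, star_inv, this]
  have hUU : star (L * ↑S⁻¹) * (L * ↑S⁻¹) = 1 := by
    rw [star_mul, hSinv, mul_assoc, ← mul_assoc (star L), ← hS]
    simp
  refine ⟨L * ↑S⁻¹, Unitary.mem_iff.2 ⟨hUU, ?_⟩, ?_⟩
  · exact ((hunit.mul S⁻¹.isUnit).mul_right_cancel (by rw [mul_assoc, hUU, mul_one, one_mul]))
  · rw [mul_assoc, hcomm.units_inv_left.eq, ← mul_assoc, hL.mul_eq, mul_assoc]

section Operators

open Module

variable {E : Type*} [NormedAddCommGroup E] [InnerProductSpace ℂ E]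

variable [FiniteDimensional ℂ E]

lemma Submodule.trace_starProjection (U : Submodule ℂ E) :
    LinearMap.trace ℂ E U.starProjection = finrank ℂ U :=
  LinearMap.IsProj.trace ⟨fun x => U.starProjection_apply_mem x,
    fun _ hx => Submodule.starProjection_eq_self_iff.2 hx⟩

variable [CompleteSpace E]

lemma ContinuousLinearMap.mul_starProjection_eq {A : E →L[ℂ] E}
    {U V : Submodule ℂ E}
    (h : ∀ u ∈ U, A u ∈ V) (h' : ∀ v ∈ V, star A v ∈ U) :
    A * U.starProjection = V.starProjection * A := by
  ext x
  refine (Submodule.eq_starProjection_of_mem_orthogonal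
    (h _ (Submodule.starProjection_apply_mem U x)) ?_).symm
  rw [Submodule.mem_orthogonal]
  intro v hv
  rw [ContinuousLinearMap.coe_coe, ← map_sub, ← ContinuousLinearMap.adjoint_inner_left]
  exact (Submodule.mem_orthogonal U _).1 (Submodule.sub_starProjection_mem_orthogonal x) _ (h' v hv)

/-- A doubly stochastic family that carries `P` into `Q`, and whose adjoints carry `Q` into `P`,
forces `P` and `Q` to have the same dimension. -/
lemma finrank_eq_of_doublyStochastic {ι : Type*} [Fintype ι] {K : ι → E →L[ℂ] E}
    (h₁ : ∑ i, K i * star (K i) = 1) (h₂ : ∑ i, star (K i) * K i = 1) {P Q : Submodule ℂ E}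
    (hP : ∀ i, ∀ v ∈ P, K i v ∈ Q) (hQ : ∀ i, ∀ v ∈ Q, star (K i) v ∈ P) :
    finrank ℂ P = finrank ℂ Q := by
  have key : LinearMap.trace ℂ E P.starProjection = LinearMap.trace ℂ E Q.starProjection := by
    calc LinearMap.trace ℂ E P.starProjection
        = LinearMap.trace ℂ E ↑(∑ i, star (K i) * (K i * P.starProjection)) := by
          simp_rw [← mul_assoc, ← Finset.sum_mul, h₂, one_mul]
      _ = LinearMap.trace ℂ E ↑(∑ i, Q.starProjection * K i * star (K i)) := by
          simp_rw [ContinuousLinearMap.toLinearMap_sum, map_sum,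
            ContinuousLinearMap.toLinearMap_mul]
          refine Finset.sum_congr rfl fun i _ => ?_
          rw [LinearMap.trace_mul_comm, ← ContinuousLinearMap.toLinearMap_mul,
            ContinuousLinearMap.mul_starProjection_eq (hP i) (hQ i),
            ContinuousLinearMap.toLinearMap_mul]
      _ = LinearMap.trace ℂ E Q.starProjection := by
          simp_rw [mul_assoc, ← Finset.mul_sum, h₁, mul_one]
  simpa [Submodule.trace_starProjection] using key

lemma StarIntertwines.starProjection_ker {X Y L : E →L[ℂ] E} (hL : StarIntertwines X Y L) :
    StarIntertwines X X L.ker.starProjection := by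
  have h₁ : ∀ v ∈ L.ker, X v ∈ L.ker := fun v hv => by
    rw [LinearMap.mem_ker, ContinuousLinearMap.coe_coe] at hv ⊢
    rw [show L (X v) = Y (L v) from congr($hL.mul_eq v), hv, map_zero]
  have h₂ : ∀ v ∈ L.ker, star X v ∈ L.ker := fun v hv => by
    rw [LinearMap.mem_ker, ContinuousLinearMap.coe_coe] at hv ⊢
    rw [show L (star X v) = star Y (L v) from congr($hL.mul_star_eq v), hv, map_zero]
  exact ⟨(ContinuousLinearMap.mul_starProjection_eq h₁ h₂).symm,
    (ContinuousLinearMap.mul_starProjection_eq h₂ (by simpa using h₁)).symm⟩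

/-- An intertwiner of minimal kernel maps its kernel under every other intertwiner into its
range. -/
lemma StarIntertwines.mem_range_of_minimal_ker {X Y K L : E →L[ℂ] E} (hK : StarIntertwines X Y K)
    (hmin : ∀ J : E →L[ℂ] E, StarIntertwines X Y J → J.ker ≤ K.ker → K.ker ≤ J.ker)
    (hL : StarIntertwines X Y L) {v : E} (hv : v ∈ K.ker) : L v ∈ K.range := by
  set p := K.ker.starProjection
  set q := (star K).ker.starProjection with hq
  have hJ : StarIntertwines X Y (q * (L * p)) :=
    (hK.adjoint.starProjection_ker).mul (hL.mul (hK.starProjection_ker))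
  have orth (w : E) (hw : w ∈ K.range) : q w = 0 := by
    rw [hq, Submodule.starProjection_apply_eq_zero_iff]
    rw [show (star K).ker = K.rangeᗮ from (ContinuousLinearMap.orthogonal_range K).symm]
    exact Submodule.le_orthogonal_orthogonal _ hw
  have hqL : q (L v) = 0 := by
    have hle : (K + q * (L * p)).ker ≤ K.ker := by
      intro w hw
      have h0 : K w + q (L (p w)) = 0 := hw
      have h1 : q (L (p w)) = 0 := by
        have := congrArg q h0
        rw [map_add, show q (K w) = 0 from orth _ ⟨w, rfl⟩, zero_add, map_zero] at this
        rwa [hq, Submodule.starProjection_eq_self_iff.2 (Submodule.starProjection_apply_mem _ _)]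
          at this
      simpa [h1] using h0
    have h0 : K v + q (L (p v)) = 0 := hmin _ (hK.add hJ) hle hv
    rwa [show K v = 0 from hv, zero_add,
      show p v = v from Submodule.starProjection_eq_self_iff.2 hv] at h0
  rw [hq, Submodule.starProjection_apply_eq_zero_iff,
    show (star K).ker = K.rangeᗮ from (ContinuousLinearMap.orthogonal_range K).symm,
    Submodule.orthogonal_orthogonal] at hqL
  exact hqL

lemma exists_isUnit_starIntertwines {ι : Type*} [Fintype ι] {X Y : E →L[ℂ] E}
    {K : ι → E →L[ℂ] E} (hK : ∀ i, StarIntertwines X Y (K i))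
    (h₁ : ∑ i, K i * star (K i) = 1) (h₂ : ∑ i, star (K i) * K i = 1) :
    ∃ L : E →L[ℂ] E, StarIntertwines X Y L ∧ IsUnit L := by
  obtain ⟨N, ⟨T, hT, rfl⟩, hmin⟩ := exists_minimal_of_wellFoundedLT
    (fun N : Submodule ℂ E => ∃ L : E →L[ℂ] E, StarIntertwines X Y L ∧ L.ker = N)
    ⟨_, 0, ⟨by simp, by simp⟩, rfl⟩
  refine ⟨T, hT, ?_⟩
  rw [ContinuousLinearMap.isUnit_iff_isUnit_toLinearMap, LinearMap.isUnit_iff_ker_eq_bot]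
  let Q : Submodule ℂ E := ⨆ L : {L : E →L[ℂ] E // StarIntertwines X Y L}, T.ker.map L.1.toLinearMap
  let P : Submodule ℂ E := ⨆ L : {L : E →L[ℂ] E // StarIntertwines X Y L},
    Q.map (star L.1).toLinearMap
  have mem_Q {L : E →L[ℂ] E} (hL : StarIntertwines X Y L) {v : E} (hv : v ∈ T.ker) : L v ∈ Q :=
    Submodule.mem_iSup_of_mem ⟨L, hL⟩ ⟨v, hv, rfl⟩
  have star_mem_P {L : E →L[ℂ] E} (hL : StarIntertwines X Y L) {w : E} (hw : w ∈ Q) :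
      star L w ∈ P :=
    Submodule.mem_iSup_of_mem ⟨L, hL⟩ ⟨w, hw, rfl⟩
  have Q_le_range : Q ≤ T.range := by
    refine iSup_le ?_
    rintro ⟨L, hL⟩ _ ⟨v, hv, rfl⟩
    exact hT.mem_range_of_minimal_ker (fun J hJ => hmin ⟨J, hJ, rfl⟩) hL hv
  have P_map {L : E →L[ℂ] E} (hL : StarIntertwines X Y L) : P ≤ Q.comap L.toLinearMap := by
    refine iSup_le ?_
    rintro ⟨J, hJ⟩
    rw [Submodule.map_le_iff_le_comap]
    refine iSup_le ?_
    rintro ⟨M, hM⟩ _ ⟨v, hv, rfl⟩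
    exact mem_Q (hL.mul (hJ.adjoint.mul hM)) hv
  have ker_le : T.ker ≤ P := by
    intro v hv
    have : v = ∑ i, star (K i) (K i v) := by
      simpa using congr($h₂.symm v)
    rw [this]
    exact Submodule.sum_mem _ fun i _ => star_mem_P (hK i) (mem_Q (hK i) hv)
  have star_range {w : E} (hw : T (star T w) = 0) : star T w = 0 := by
    have : w ∈ (T * star T).ker := hw
    rwa [show (T * star T).ker = (star T).ker from ContinuousLinearMap.ker_self_comp_adjoint T]
      at this
  have range_ker {w : E} (hw : w ∈ T.range) (h0 : star T w = 0) : w = 0 := by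
    obtain ⟨u, rfl⟩ := hw
    have : u ∈ (star T * T).ker := h0
    rwa [show (star T * T).ker = T.ker from ContinuousLinearMap.ker_adjoint_comp_self T] at this
  have hPQ : finrank ℂ P = finrank ℂ Q := finrank_eq_of_doublyStochastic h₁ h₂
    (fun i v hv => P_map (hK i) hv) (fun i w hw => star_mem_P (hK i) hw)
  have hmap : finrank ℂ (Q.map (star T).toLinearMap) = finrank ℂ Q := by
    rw [← LinearMap.range_domRestrict]
    refine LinearMap.finrank_range_of_inj ((injective_iff_map_eq_zero _).2 fun w hw => ?_)
    exact Subtype.ext (range_ker (Q_le_range w.2) hw)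
  have heq : Q.map (star T).toLinearMap = P :=
    Submodule.eq_of_le_of_finrank_eq (Submodule.map_le_iff_le_comap.2 fun w hw => star_mem_P hT hw)
      (hmap.trans hPQ.symm)
  rw [eq_bot_iff]
  intro v hv
  obtain ⟨w, -, rfl⟩ := heq ▸ ker_le hv
  exact star_range hv

end Operators

section Kraus

variable {n : ℕ} {Φ : Matrix (Fin n) (Fin n) ℂ →ₗ[ℂ] Matrix (Fin n) (Fin n) ℂ}

/-- **Kraus decomposition** of a completely positive map. -/
lemma IsCompletelyPositive.exists_kraus (hΦ : IsCompletelyPositive Φ) :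
    ∃ (r : ℕ) (K : Fin r → Matrix (Fin n) (Fin n) ℂ), ∀ A, Φ A = ∑ i, K i * A * (K i)ᴴ := by
  let e : Fin n × Fin n → ℂ := fun p => if p.1 = p.2 then 1 else 0
  obtain ⟨r, v, hv⟩ := Matrix.posSemidef_iff_eq_sum_vecMulVec.1
    (hΦ n _ (Matrix.posSemidef_vecMulVec_self_star e))
  refine ⟨r, fun i => Matrix.of fun x a => v i (a, x), fun A => ?_⟩
  have hsingle (a b x y : Fin n) :
      Φ (Matrix.single a b 1) x y = ∑ i, v i (a, x) * star (v i (b, y)) := by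
    have h := congr($hv (a, x) (b, y))
    have he : (Matrix.of fun x y => Matrix.vecMulVec e (star e) (a, x) (b, y)) =
        Matrix.single a b (1 : ℂ) := by
      ext x y
      by_cases hx : a = x <;> by_cases hy : b = y <;>
        simp [e, Matrix.vecMulVec_apply, hx, hy]
    rw [Matrix.of_apply, he] at h
    simpa [Matrix.sum_apply, Matrix.vecMulVec_apply] using h
  have hA : A = ∑ a, ∑ b, A a b • Matrix.single a b (1 : ℂ) := by
    simpa [Matrix.smul_single] using Matrix.matrix_eq_sum_single A
  ext x y
  conv_lhs => rw [hA]
  simp only [map_sum, map_smul, Matrix.sum_apply, Matrix.smul_apply, hsingle, smul_eq_mul,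
    Matrix.mul_apply, Matrix.conjTranspose_apply, Matrix.of_apply, Finset.sum_mul, Finset.mul_sum]
  rw [Finset.sum_comm_cycle]
  refine Finset.sum_congr rfl fun i _ => Finset.sum_comm.trans ?_
  simp only [mul_left_comm, mul_assoc]

variable {r : ℕ} {K : Fin r → Matrix (Fin n) (Fin n) ℂ}

lemma kraus_sum_mul_conjTranspose (hK : ∀ A, Φ A = ∑ i, K i * A * (K i)ᴴ) (hu : Φ 1 = 1) :
    ∑ i, K i * (K i)ᴴ = 1 := by
  simpa [hu] using (hK 1).symm

lemma kraus_sum_conjTranspose_mul (hK : ∀ A, Φ A = ∑ i, K i * A * (K i)ᴴ)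
    (htp : ∀ A, (Φ A).trace = A.trace) : ∑ i, (K i)ᴴ * K i = 1 := by
  refine Matrix.ext_iff_trace_mul_right.2 fun A => ?_
  rw [one_mul, ← htp A, hK A, Finset.sum_mul, Matrix.trace_sum, Matrix.trace_sum]
  refine Finset.sum_congr rfl fun i _ => ?_
  rw [mul_assoc, Matrix.trace_mul_comm]

lemma kraus_map_conjTranspose (hK : ∀ A, Φ A = ∑ i, K i * A * (K i)ᴴ) (A) : Φ Aᴴ = (Φ A)ᴴ := by
  simp [hK, Matrix.conjTranspose_sum, mul_assoc]

lemma kraus_sum_defect (hK : ∀ A, Φ A = ∑ i, K i * A * (K i)ᴴ)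
    (htp : ∀ A, (Φ A).trace = A.trace) (hu : Φ 1 = 1) (X : Matrix (Fin n) (Fin n) ℂ) :
    ∑ i, ((K i * X - Φ X * K i) * (K i * X - Φ X * K i)ᴴ).trace =
      (X * Xᴴ).trace - (Φ X * (Φ X)ᴴ).trace := by
  have h1 := kraus_sum_mul_conjTranspose hK hu
  have hexp : ∑ i, (K i * X - Φ X * K i) * (K i * X - Φ X * K i)ᴴ =
      Φ (X * Xᴴ) - Φ X * (Φ X)ᴴ - Φ X * Φ Xᴴ + Φ X * 1 * (Φ X)ᴴ := by
    generalize hY : Φ X = Y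
    rw [← h1, hK (X * Xᴴ), hK Xᴴ]
    conv_rhs => enter [1, 1, 2, 1]; rw [← hY, hK X]
    simp only [Finset.sum_mul, Finset.mul_sum, ← Finset.sum_sub_distrib, ← Finset.sum_add_distrib]
    refine Finset.sum_congr rfl fun i _ => ?_
    simp only [Matrix.conjTranspose_sub, Matrix.conjTranspose_mul]
    noncomm_ring
  rw [← Matrix.trace_sum, hexp, kraus_map_conjTranspose hK, mul_one, sub_add_cancel,
    Matrix.trace_sub, htp]

lemma trace_map_mul_conjTranspose_le (hΦ : IsCompletelyPositive Φ)
    (htp : ∀ A, (Φ A).trace = A.trace) (hu : Φ 1 = 1) (X : Matrix (Fin n) (Fin n) ℂ) :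
    (Φ X * (Φ X)ᴴ).trace ≤ (X * Xᴴ).trace := by
  obtain ⟨r, K, hK⟩ := hΦ.exists_kraus
  rw [← sub_nonneg, ← kraus_sum_defect hK htp hu]
  exact Finset.sum_nonneg fun i _ => (Matrix.posSemidef_self_mul_conjTranspose _).trace_nonneg

lemma kraus_mul_eq (hK : ∀ A, Φ A = ∑ i, K i * A * (K i)ᴴ)
    (htp : ∀ A, (Φ A).trace = A.trace) (hu : Φ 1 = 1) {X : Matrix (Fin n) (Fin n) ℂ}
    (hX : (X * Xᴴ).trace ≤ (Φ X * (Φ X)ᴴ).trace) (i : Fin r) : K i * X = Φ X * K i := by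
  have hnonneg (j : Fin r) : 0 ≤ ((K j * X - Φ X * K j) * (K j * X - Φ X * K j)ᴴ).trace :=
    (Matrix.posSemidef_self_mul_conjTranspose _).trace_nonneg
  have hsum : ∑ i, ((K i * X - Φ X * K i) * (K i * X - Φ X * K i)ᴴ).trace = 0 :=
    le_antisymm (by rw [kraus_sum_defect hK htp hu]; exact sub_nonpos.2 hX)
      (Finset.sum_nonneg fun j _ => hnonneg j)
  have h0 := (Finset.sum_eq_zero_iff_of_nonneg fun j _ => hnonneg j).1 hsum i (Finset.mem_univ i)
  exact sub_eq_zero.1 (Matrix.trace_mul_conjTranspose_self_eq_zero_iff.1 h0)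

end Kraus

/-- If `Φ` is a completely positive, trace-preserving, unital map with
`Φ(X) = Y` and there is another such map `Ψ` with `Ψ(Y) = X`, then `X` and `Y` are
cospectral (same characteristic polynomial); in fact there is a unitary `U` with
`Y = U X U*`. -/
theorem stmt4 (n : ℕ)
    (Φ Ψ : Matrix (Fin n) (Fin n) ℂ →ₗ[ℂ] Matrix (Fin n) (Fin n) ℂ)
    (hcp1 : IsCompletelyPositive Φ) (hcp2 : IsCompletelyPositive Ψ)
    (htp1 : ∀ W, (Φ W).trace = W.trace) (htp2 : ∀ W, (Ψ W).trace = W.trace)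
    (hu1 : Φ 1 = 1) (hu2 : Ψ 1 = 1)
    (X Y : Matrix (Fin n) (Fin n) ℂ) (hXY : Φ X = Y) (hYX : Ψ Y = X) :
    X.charpoly = Y.charpoly ∧
      ∃ U : Matrix (Fin n) (Fin n) ℂ, U * Uᴴ = 1 ∧ Uᴴ * U = 1 ∧ Y = U * X * Uᴴ := by
  obtain ⟨r, K, hK⟩ := hcp1.exists_kraus
  obtain ⟨s, J, hJ⟩ := hcp2.exists_kraus
  have h₁ := kraus_sum_mul_conjTranspose hK hu1
  have h₂ := kraus_sum_conjTranspose_mul hK htp1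
  have hXY' : Φ Xᴴ = Yᴴ := by rw [kraus_map_conjTranspose hK, hXY]
  have hYX' : Ψ Yᴴ = Xᴴ := by rw [kraus_map_conjTranspose hJ, hYX]
  let T := Matrix.toEuclideanCLM (n := Fin n) (𝕜 := ℂ)
  have hTstar (A) : T Aᴴ = star (T A) := map_star T A
  have hT : ∀ i, StarIntertwines (T X) (T Y) (T (K i)) := fun i => by
    have hX := kraus_mul_eq hK htp1 hu1 (X := X)
      (by simpa [hXY, hYX] using trace_map_mul_conjTranspose_le hcp2 htp2 hu2 Y) i
    have hX' := kraus_mul_eq hK htp1 hu1 (X := Xᴴ)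
      (by simpa [hXY', hYX'] using trace_map_mul_conjTranspose_le hcp2 htp2 hu2 Yᴴ) i
    rw [hXY] at hX
    rw [hXY'] at hX'
    refine ⟨by rw [← map_mul, hX, map_mul], ?_⟩
    rw [← hTstar, ← hTstar, ← map_mul, hX', map_mul]
  obtain ⟨L, hL, hLunit⟩ := exists_isUnit_starIntertwines hT
    (by simpa [hTstar] using congrArg T h₁)
    (by simpa [hTstar] using congrArg T h₂)
  obtain ⟨V, hV, hVX⟩ := hL.exists_unitary hLunit
  obtain ⟨U, rfl⟩ : ∃ U, T U = V := ⟨T.symm V, T.apply_symm_apply V⟩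
  have hUU : Uᴴ * U = 1 :=
    EquivLike.injective T (by simpa only [map_mul, map_one, hTstar] using hV.1)
  have hUU' : U * Uᴴ = 1 := mul_eq_one_comm.1 hUU
  have hUX : U * X = Y * U := EquivLike.injective T (by simpa only [map_mul] using hVX)
  have hY : Y = U * X * Uᴴ := by rw [hUX, mul_assoc, hUU', mul_one]
  refine ⟨?_, U, hUU', hUU, hY⟩
  rw [hY, mul_assoc, Matrix.charpoly_mul_comm, mul_assoc, hUU, mul_one]
end

section
/- Let A and B be self-adjoint unital subalgebras of ℂ^{n×n} and let φ : A → B be a trace-preserving algebra isomorphism such that φ(X*) = φ(X)* for all X ∈ A. Then there exists a unitary U ∈ ℂ^{n×n} such that φ(X) = U X U* for all X ∈ A. -/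
open Matrix

section PartialIsometry

open scoped ComplexOrder

variable {m : Type*} [Fintype m] [DecidableEq m]

/-- The bicommutant of `Sᴴ * S` contains a Hermitian `F` inverting the square root of `Sᴴ * S` on
the range of `Sᴴ`, so that `S * F` is the partial isometry of the polar decomposition of `S`. -/
lemma exists_isHermitian_mul_mul_conjTranspose_mul_self (S : Matrix m m ℂ) :
    ∃ F : Matrix m m ℂ, F.IsHermitian ∧ (∀ M, Commute (Sᴴ * S) M → Commute F M) ∧
      S * F * F * (Sᴴ * S) = S := by
  have hS : (Sᴴ * S).PosSemidef := posSemidef_conjTranspose_mul_self S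
  have hsa : IsSelfAdjoint (Sᴴ * S) := hS.isHermitian
  let f : ℝ → ℝ := fun x ↦ (√x)⁻¹
  have hc (g : ℝ → ℝ) : ContinuousOn g (spectrum ℝ (Sᴴ * S)) :=
    (finite_real_spectrum (A := Sᴴ * S)).continuousOn g
  refine ⟨cfc f (Sᴴ * S), cfc_predicate f _, fun M hM ↦ hM.cfc_real f, ?_⟩
  have key : Sᴴ * S * (cfc f (Sᴴ * S) * cfc f (Sᴴ * S) * (Sᴴ * S)) = Sᴴ * S := by
    have h : cfc (fun x ↦ x * (f x * f x * x)) (Sᴴ * S) = Sᴴ * S := by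
      conv_rhs => rw [← cfc_id ℝ (Sᴴ * S)]
      refine cfc_congr fun x hx ↦ ?_
      have hx0 : 0 ≤ x := by
        rw [hS.isHermitian.spectrum_real_eq_range_eigenvalues] at hx
        obtain ⟨i, rfl⟩ := hx
        exact hS.eigenvalues_nonneg i
      obtain rfl | hpos := hx0.eq_or_lt
      · simp
      · have hsq := Real.mul_self_sqrt hx0
        have hne : √x ≠ 0 := (Real.sqrt_pos.mpr hpos).ne'
        simp only [f, id]
        field_simp
        nlinarith
    rw [cfc_mul _ _ _ (hc _) (hc _), cfc_mul _ _ _ (hc _) (hc _), cfc_mul _ _ _ (hc _) (hc _),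
      cfc_id' ℝ (Sᴴ * S)] at h
    exact h
  have := (conjTranspose_mul_self_mul_eq_zero S
    (cfc f (Sᴴ * S) * cfc f (Sᴴ * S) * (Sᴴ * S) - 1)).mp (by rw [mul_sub, key, mul_one, sub_self])
  rw [mul_sub, mul_one, sub_eq_zero] at this
  simpa only [mul_assoc] using this

/-- Partial isometries with orthogonal initial spaces and orthogonal final spaces add up to a
partial isometry. -/
lemma add_mul_conjTranspose_mul_add {V W : Matrix m m ℂ} (hV : V * Vᴴ * V = V)
    (hW : W * Wᴴ * W = W) (hi : W * Vᴴ = 0) (hf : Wᴴ * V = 0) :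
    (W + V) * (W + V)ᴴ * (W + V) = W + V := by
  have hi' : V * Wᴴ = 0 := by simpa using congrArg conjTranspose hi
  have hf' : Vᴴ * W = 0 := by simpa using congrArg conjTranspose hf
  simp [mul_add, add_mul, hi, hi', hV, hW, mul_assoc _ _ W, mul_assoc _ _ V, hf, hf']

end PartialIsometry

section Intertwiner

open scoped ComplexOrder

variable {n : ℕ} {A B : Subalgebra ℂ (Matrix (Fin n) (Fin n) ℂ)}

/-- The trace form of a subalgebra of a matrix algebra. -/
noncomputable def matrixTraceForm (A : Subalgebra ℂ (Matrix (Fin n) (Fin n) ℂ)) :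
    LinearMap.BilinForm ℂ A :=
  (LinearMap.mul ℂ A).compr₂ (traceLinearMap (Fin n) ℂ ℂ ∘ₗ A.val.toLinearMap)

lemma matrixTraceForm_apply (X Y : A) :
    matrixTraceForm A X Y = ((X : Matrix (Fin n) (Fin n) ℂ) * Y).trace := rfl

lemma matrixTraceForm_isSymm : (matrixTraceForm A).IsSymm :=
  ⟨fun X Y ↦ trace_mul_comm (X : Matrix (Fin n) (Fin n) ℂ) Y⟩

lemma matrixTraceForm_nondegenerate (hA : ∀ X ∈ A, Xᴴ ∈ A) : (matrixTraceForm A).Nondegenerate := by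
  refine matrixTraceForm_isSymm.isRefl.nondegenerate_iff_separatingLeft.mpr fun X hX ↦ ?_
  have := hX ⟨_, hA _ X.2⟩
  rw [matrixTraceForm_apply, trace_mul_conjTranspose_self_eq_zero_iff] at this
  exact Subtype.ext this

/-- The twisted Casimir element of the trace form intertwines the inclusion of `A` and `φ`. -/
lemma map_mul_sum_dualBasis {ι : Type*} [Fintype ι] [DecidableEq ι] (φ : A →ₐ[ℂ] B)
    (hnd : (matrixTraceForm A).Nondegenerate) (b : Module.Basis ι ℂ A)
    (T : Matrix (Fin n) (Fin n) ℂ) (X : A) :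
    (φ X : Matrix (Fin n) (Fin n) ℂ) *
        ∑ i, φ (b i) * T * ((matrixTraceForm A).dualBasis hnd b i : Matrix (Fin n) (Fin n) ℂ) =
      (∑ i, φ (b i) * T * ((matrixTraceForm A).dualBasis hnd b i : Matrix (Fin n) (Fin n) ℂ)) * X := by
  set d := (matrixTraceForm A).dualBasis hnd b with hd
  have hl (i : ι) : X * b i = ∑ j, matrixTraceForm A (d j) (X * b i) • b j := by
    refine (b.sum_repr (X * b i)).symm.trans ?_
    refine Finset.sum_congr rfl fun j _ ↦ ?_
    congr 1
    conv_rhs => rw [← b.sum_repr (X * b i), map_sum]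
    simp [hd, LinearMap.BilinForm.apply_dualBasis_left]
  have hr (j : ι) : d j * X = ∑ i, matrixTraceForm A (d j) (X * b i) • d i := by
    refine (d.sum_repr (d j * X)).symm.trans ?_
    refine Finset.sum_congr rfl fun i _ ↦ ?_
    rw [hd, LinearMap.BilinForm.dualBasis_repr_apply]
    simp [matrixTraceForm_apply, mul_assoc]
  have hl' (i : ι) : (φ X : Matrix (Fin n) (Fin n) ℂ) * φ (b i) =
      ∑ j, matrixTraceForm A (d j) (X * b i) • (φ (b j) : Matrix (Fin n) (Fin n) ℂ) := by
    have := congrArg (fun Y ↦ (φ Y : Matrix (Fin n) (Fin n) ℂ)) (hl i)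
    simpa using this
  have hr' (j : ι) : (d j : Matrix (Fin n) (Fin n) ℂ) * X =
      ∑ i, matrixTraceForm A (d j) (X * b i) • (d i : Matrix (Fin n) (Fin n) ℂ) := by
    have := congrArg (fun Y : A ↦ (Y : Matrix (Fin n) (Fin n) ℂ)) (hr j)
    simpa using this
  simp_rw [Finset.mul_sum, Finset.sum_mul, ← mul_assoc, hl',
    mul_assoc _ _ (X : Matrix (Fin n) (Fin n) ℂ), hr', Finset.sum_mul, Finset.mul_sum]
  rw [Finset.sum_comm]
  simp

/-- If matrices `P` and `Q` define the same nonzero trace functional on `A` through the inclusion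
and through `φ`, some nonzero matrix of the form `Q * S * P` comes from an intertwiner `S`. -/
lemma exists_intertwiner_mul_mul_ne_zero (hA : ∀ X ∈ A, Xᴴ ∈ A) (φ : A →ₐ[ℂ] B)
    {P Q : Matrix (Fin n) (Fin n) ℂ} (hP : P.IsHermitian) (hP0 : P.trace ≠ 0)
    (hPQ : ∀ X : A, (Q * (φ X : Matrix (Fin n) (Fin n) ℂ)).trace =
      (P * (X : Matrix (Fin n) (Fin n) ℂ)).trace) :
    ∃ S : Matrix (Fin n) (Fin n) ℂ,
      (∀ X : A, (φ X : Matrix (Fin n) (Fin n) ℂ) * S = S * X) ∧ Q * S * P ≠ 0 := by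
  have hnd := matrixTraceForm_nondegenerate hA
  let b := Module.finBasis ℂ A
  let d := (matrixTraceForm A).dualBasis hnd b
  by_contra! h
  have hT (T : Matrix (Fin n) (Fin n) ℂ) :
      ∑ i, (Q * φ (b i)) * T * ((d i : Matrix (Fin n) (Fin n) ℂ) * P) = 0 := by
    have := h _ (map_mul_sum_dualBasis φ hnd b T)
    simpa only [Finset.mul_sum, Finset.sum_mul, mul_assoc] using this
  let c : A := ∑ i, (Q * (φ (b i) : Matrix (Fin n) (Fin n) ℂ)).trace • d i
  have hcP : (c : Matrix (Fin n) (Fin n) ℂ) * P = 0 := by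
    ext l k
    have hk (j : Fin n) :
        ∑ i, (Q * φ (b i)) j j * ((d i : Matrix (Fin n) (Fin n) ℂ) * P) l k = 0 := by
      have := congrFun₂ (hT (single j l 1)) j k
      simpa [Matrix.sum_apply, mul_apply (M := _ * single j l _), mul_apply (N := single j l _),
        single_apply, ite_and] using this
    have hsum := Finset.sum_eq_zero fun j (_ : j ∈ Finset.univ) ↦ hk j
    rw [Finset.sum_comm] at hsum
    simpa [c, Finset.sum_mul, Matrix.sum_apply, trace] using hsum
  have hc (X : A) : ((c : Matrix (Fin n) (Fin n) ℂ) * X).trace =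
      (P * (X : Matrix (Fin n) (Fin n) ℂ)).trace := by
    have hX : ∑ i, matrixTraceForm A (d i) X • b i = X := by
      conv_rhs => rw [← b.sum_repr X]
      refine Finset.sum_congr rfl fun i _ ↦ congrArg (· • b i) ?_
      conv_lhs => rw [← b.sum_repr X, map_sum]
      simp [d, LinearMap.BilinForm.apply_dualBasis_left]
    rw [← hPQ]
    conv_rhs => rw [← hX]
    simp only [c, map_sum, map_smul, AddSubmonoidClass.coe_finsetSum, SetLike.val_smul,
      Finset.sum_mul, Finset.mul_sum, trace_sum, smul_mul_assoc, mul_smul_comm, trace_smul,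
      smul_eq_mul, matrixTraceForm_apply]
    exact Finset.sum_congr rfl fun i _ ↦ mul_comm _ _
  have hc0 : (c : Matrix (Fin n) (Fin n) ℂ) = 0 := by
    have := hc ⟨_, hA _ c.2⟩
    have h2 : P * (c : Matrix (Fin n) (Fin n) ℂ)ᴴ = 0 := by
      simpa [hP.eq] using congrArg conjTranspose hcP
    rwa [h2, trace_zero, trace_mul_conjTranspose_self_eq_zero_iff] at this
  have := hc 1
  simp [hc0] at this
  exact hP0 this.symm

/-- A partial isometry which intertwines and is not an isometry extends to a larger one. -/
lemma exists_partialIsometry_ker_lt (hA : ∀ X ∈ A, Xᴴ ∈ A) (φ : A →ₐ[ℂ] B)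
    (htr : ∀ X : A, ((φ X : Matrix (Fin n) (Fin n) ℂ)).trace
      = (X : Matrix (Fin n) (Fin n) ℂ).trace)
    (hstar : ∀ X : A, ((φ X : Matrix (Fin n) (Fin n) ℂ))ᴴ
      = (φ ⟨(X : Matrix (Fin n) (Fin n) ℂ)ᴴ, hA _ X.2⟩ : Matrix (Fin n) (Fin n) ℂ))
    {W : Matrix (Fin n) (Fin n) ℂ} (hW : W * Wᴴ * W = W)
    (hφ : ∀ X : A, (φ X : Matrix (Fin n) (Fin n) ℂ) * W = W * X) (hne : Wᴴ * W ≠ 1) :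
    ∃ W' : Matrix (Fin n) (Fin n) ℂ, W' * W'ᴴ * W' = W' ∧
      (∀ X : A, (φ X : Matrix (Fin n) (Fin n) ℂ) * W' = W' * X) ∧
      LinearMap.ker W'.mulVecLin < LinearMap.ker W.mulVecLin := by
  have adj {S : Matrix (Fin n) (Fin n) ℂ}
      (hS : ∀ X : A, (φ X : Matrix (Fin n) (Fin n) ℂ) * S = S * X) (X : A) :
      Sᴴ * (φ X : Matrix (Fin n) (Fin n) ℂ) = X * Sᴴ := by
    have := congrArg conjTranspose (hS ⟨_, hA _ X.2⟩)
    rw [conjTranspose_mul, ← hstar] at this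
    simpa using this
  have hφ' := adj hφ
  set P := 1 - Wᴴ * W with hPdef
  set Q := 1 - W * Wᴴ with hQdef
  have hP : P.IsHermitian := by simp [IsHermitian, hPdef]
  have hQ : Q.IsHermitian := by simp [IsHermitian, hQdef]
  have hWP : W * P = 0 := by rw [hPdef, mul_sub, ← mul_assoc, hW]; simp
  have hQW : Q * W = 0 := by rw [hQdef, sub_mul, hW]; simp
  have hPP : P * P = P := by
    nth_rw 1 [hPdef]
    simp [sub_mul, mul_assoc, hWP]
  have hQQ : Q * Q = Q := by
    nth_rw 2 [hQdef]
    simp [mul_sub, ← mul_assoc, hQW]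
  have hP0 : P.trace ≠ 0 := by
    intro h0
    have : (Pᴴ * P).trace = 0 := by rw [hP.eq, hPP, h0]
    rw [trace_conjTranspose_mul_self_eq_zero_iff] at this
    exact hne (sub_eq_zero.mp this).symm
  have hPQ (X : A) : (Q * (φ X : Matrix (Fin n) (Fin n) ℂ)).trace =
      (P * (X : Matrix (Fin n) (Fin n) ℂ)).trace := by
    rw [hPdef, hQdef, sub_mul, sub_mul, trace_sub, trace_sub, one_mul, one_mul, htr,
      mul_assoc W, hφ', trace_mul_comm W, trace_mul_comm (Wᴴ * W), ← mul_assoc]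
  obtain ⟨S₀, hS₀, hne₀⟩ := exists_intertwiner_mul_mul_ne_zero hA φ hP hP0 hPQ
  obtain ⟨S, hSdef⟩ : ∃ S, S = Q * S₀ * P := ⟨_, rfl⟩
  rw [← hSdef] at hne₀
  have hXP (X : A) : P * (X : Matrix (Fin n) (Fin n) ℂ) = X * P := by
    rw [hPdef, sub_mul, mul_sub, mul_assoc, ← hφ, ← mul_assoc, hφ']; simp [mul_assoc]
  have hXQ (X : A) : Q * (φ X : Matrix (Fin n) (Fin n) ℂ) = φ X * Q := by
    rw [hQdef, sub_mul, mul_sub, mul_assoc, hφ', ← mul_assoc, ← hφ]; simp [mul_assoc]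
  have hS (X : A) : (φ X : Matrix (Fin n) (Fin n) ℂ) * S = S * X := by
    rw [hSdef, mul_assoc _ P, hXP, mul_assoc Q S₀ (X * P), ← mul_assoc S₀, ← hS₀]
    simp only [← mul_assoc, hXQ]
  have hSP : S * P = S := by rw [hSdef, mul_assoc, hPP]
  have hQS : Q * S = S := by rw [hSdef, ← mul_assoc, ← mul_assoc, hQQ]
  have hPS : P * Sᴴ = Sᴴ := by simpa [hP.eq] using congrArg conjTranspose hSP
  obtain ⟨F, hF, hcomm, hSF⟩ := exists_isHermitian_mul_mul_conjTranspose_mul_self S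
  obtain ⟨V, hVdef⟩ : ∃ V, V = S * F := ⟨_, rfl⟩
  have hFP : F * P = P * F := hcomm P (by
    rw [Commute, SemiconjBy, mul_assoc, hSP, ← mul_assoc, hPS])
  have hFX (X : A) : F * (X : Matrix (Fin n) (Fin n) ℂ) = X * F := hcomm X (by
    rw [Commute, SemiconjBy, mul_assoc, ← hS, ← mul_assoc, adj hS, mul_assoc])
  have hVP : V * P = V := by rw [hVdef, mul_assoc, hFP, ← mul_assoc, hSP]
  have hQV : Q * V = V := by rw [hVdef, ← mul_assoc, hQS]
  have hV : V * Vᴴ * V = V := by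
    rw [hVdef, conjTranspose_mul, hF.eq]
    simpa only [mul_assoc] using congrArg (· * F) hSF
  have hVφ (X : A) : (φ X : Matrix (Fin n) (Fin n) ℂ) * V = V * X := by
    rw [hVdef, ← mul_assoc, hS, mul_assoc, mul_assoc, hFX]
  have hV0 : V ≠ 0 := fun h0 ↦ hne₀ (by rw [← hSF, ← hVdef, h0]; simp)
  have hi : W * Vᴴ = 0 := by
    rw [← hVP, conjTranspose_mul, hP.eq, ← mul_assoc, hWP, zero_mul]
  have hf : Wᴴ * V = 0 := by
    have : Wᴴ * Q = 0 := by simpa [hQ.eq] using congrArg conjTranspose hQW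
    rw [← hQV, ← mul_assoc, this, zero_mul]
  refine ⟨W + V, add_mul_conjTranspose_mul_add hV hW hi hf,
    fun X ↦ by rw [mul_add, add_mul, hφ, hVφ], ?_, fun hle ↦ hV0 ?_⟩
  · intro v hv
    simp only [LinearMap.mem_ker, mulVecLin_apply] at hv ⊢
    have := congrArg ((W * Wᴴ) *ᵥ ·) hv
    simpa [mulVec_mulVec, mul_add, hW, mul_assoc W, hf, ← mul_assoc W Wᴴ W] using this
  · rw [← hVP]
    refine ext_of_mulVec_single fun i ↦ ?_
    have hmem : P *ᵥ Pi.single i 1 ∈ LinearMap.ker W.mulVecLin := by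
      simp [LinearMap.mem_ker, hWP, -mulVec_single]
    have := hle hmem
    simpa [LinearMap.mem_ker, add_mul, hWP, -mulVec_single] using this

end Intertwiner

/-- Let `A` and `B` be self-adjoint unital subalgebras of `ℂ^{n×n}` and
`φ : A → B` a trace-preserving algebra isomorphism with `φ(X*) = φ(X)*` for all `X ∈ A`.
Then there is a unitary `U` with `φ(X) = U X U*` for all `X ∈ A`. -/
theorem stmt5 (n : ℕ)
    (A B : Subalgebra ℂ (Matrix (Fin n) (Fin n) ℂ))
    (hA : ∀ X ∈ A, Xᴴ ∈ A) (hB : ∀ X ∈ B, Xᴴ ∈ B)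
    (φ : A ≃ₐ[ℂ] B)
    (htr : ∀ X : A, ((φ X : Matrix (Fin n) (Fin n) ℂ)).trace
      = (X : Matrix (Fin n) (Fin n) ℂ).trace)
    (hstar : ∀ X : A, ((φ X : Matrix (Fin n) (Fin n) ℂ))ᴴ
      = (φ ⟨(X : Matrix (Fin n) (Fin n) ℂ)ᴴ, hA _ X.2⟩ : Matrix (Fin n) (Fin n) ℂ)) :
    ∃ U : Matrix (Fin n) (Fin n) ℂ, U * Uᴴ = 1 ∧ Uᴴ * U = 1 ∧
      ∀ X : A, (φ X : Matrix (Fin n) (Fin n) ℂ)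
        = U * (X : Matrix (Fin n) (Fin n) ℂ) * Uᴴ := by
  have hmin := WellFounded.has_min (wellFounded_lt (α := Submodule ℂ (Fin n → ℂ)))
    {K | ∃ W : Matrix (Fin n) (Fin n) ℂ, W * Wᴴ * W = W ∧
      (∀ X : A, (φ X : Matrix (Fin n) (Fin n) ℂ) * W = W * X) ∧ LinearMap.ker W.mulVecLin = K}
    ⟨_, 0, by simp, by simp, rfl⟩
  obtain ⟨_, ⟨U, hU, hφU, rfl⟩, hmin⟩ := hmin
  have hUU : Uᴴ * U = 1 := by
    by_contra hne
    obtain ⟨W, hW, hφW, hlt⟩ :=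
      exists_partialIsometry_ker_lt hA (φ : A →ₐ[ℂ] B) htr hstar hU hφU hne
    exact hmin _ ⟨W, hW, hφW, rfl⟩ hlt
  have hUU' : U * Uᴴ = 1 := mul_eq_one_comm.mp hUU
  exact ⟨U, hUU', hUU, fun X ↦ by rw [← hφU, mul_assoc, hUU', mul_one]⟩
end
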